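/- The multi-GGS-group depends only on the linear span of its defining vectors: if e_1,…,e_r ∈ 𝔽_p^{p−1} and f_1,…,f_s ∈ 𝔽_p^{p−1} are two linearly independent families spanning the same subspace of 𝔽_p^{p−1}, then ⟨a, b_{e_1},…,b_{e_r}⟩ = ⟨a, b_{f_1},…,b_{f_s}⟩ as subgroups of Aut(T). -/

import Mathlib

/-!
Automorphisms of the `p`-regular rooted tree, encoded by portraits:
an automorphism is a family of permutations of `Fin p`, one for each vertex
(vertices are finite words over `Fin p`, the root being `[]`).
-/

namespace TreeAut

variable {p : ℕ}

/-- Automorphisms of the `p`-regular rooted tree, given by their portraits. -/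
def AutT (p : ℕ) : Type := List (Fin p) → Equiv.Perm (Fin p)

namespace AutT

/-- The action of a tree automorphism on the vertices (finite words over `Fin p`). -/
def act : AutT p → List (Fin p) → List (Fin p)
  | _, [] => []
  | f, x :: w => f [] x :: act (fun v => f (x :: v)) w

/-- The section of `f` at the level-one vertex `x`; the map
`f ↦ (sections f 0, …, sections f (p-1))` restricted to the first-level
stabilizer is the isomorphism `ψ`. -/
def sections (f : AutT p) : Fin p → AutT p := fun x v => f (x :: v)

instance : One (AutT p) := ⟨fun _ => 1⟩

instance : Mul (AutT p) := ⟨fun f g v => f (act g v) * g v⟩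

/-- The action of the inverse automorphism on vertices. -/
def invAct : AutT p → List (Fin p) → List (Fin p)
  | _, [] => []
  | f, x :: w => (f [])⁻¹ x :: invAct (fun v => f (((f [])⁻¹ x) :: v)) w

instance : Inv (AutT p) := ⟨fun f v => (f (invAct f v))⁻¹⟩

lemma one_apply (v : List (Fin p)) : (1 : AutT p) v = 1 := rfl

lemma mul_apply (f g : AutT p) (v : List (Fin p)) : (f * g) v = f (act g v) * g v := rfl

lemma inv_apply (f : AutT p) (v : List (Fin p)) : f⁻¹ v = (f (invAct f v))⁻¹ := rfl

lemma act_nil (f : AutT p) : act f [] = [] := rfl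

lemma act_cons (f : AutT p) (x : Fin p) (w : List (Fin p)) :
    act f (x :: w) = f [] x :: act (sections f x) w := rfl

lemma sections_mul (f g : AutT p) (x : Fin p) :
    sections (f * g) x = sections f (g [] x) * sections g x :=
  funext fun _ => rfl

lemma act_one : ∀ v : List (Fin p), act (1 : AutT p) v = v
  | [] => rfl
  | x :: w => congrArg (x :: ·) (act_one w)

lemma act_mul (f g : AutT p) : ∀ v : List (Fin p), act (f * g) v = act f (act g v)
  | [] => rfl
  | x :: w => by
      rw [act_cons (f * g), sections_mul, act_mul, act_cons g, act_cons f]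
      rfl

lemma invAct_act (f : AutT p) : ∀ v : List (Fin p), invAct f (act f v) = v
  | [] => rfl
  | x :: w => by
      rw [act_cons]
      show (f [])⁻¹ (f [] x) ::
          invAct (fun v => f (((f [])⁻¹ (f [] x)) :: v)) (act (sections f x) w) = x :: w
      rw [show (f [])⁻¹ (f [] x) = x from (f []).symm_apply_apply x]
      exact congrArg (x :: ·) (invAct_act (sections f x) w)

instance : Group (AutT p) where
  mul_assoc f g h := by
    funext v
    show (f * g) (act h v) * h v = f (act (g * h) v) * (g * h) v
    rw [mul_apply, mul_apply, act_mul, mul_assoc]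
  one_mul f := by
    funext v
    show (1 : AutT p) (act f v) * f v = f v
    rw [one_apply, one_mul]
  mul_one f := by
    funext v
    show f (act (1 : AutT p) v) * (1 : AutT p) v = f v
    rw [act_one, one_apply, mul_one]
  inv_mul_cancel f := by
    funext v
    show f⁻¹ (act f v) * f v = (1 : AutT p) v
    rw [inv_apply, invAct_act, one_apply, inv_mul_cancel]

lemma act_length (f : AutT p) : ∀ v : List (Fin p), (act f v).length = v.length
  | [] => rfl
  | _ :: w => congrArg Nat.succ (act_length _ w)

lemma act_act_inv (f : AutT p) (v : List (Fin p)) : act f (act f⁻¹ v) = v := by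
  rw [← act_mul, mul_inv_cancel, act_one]

/-- The pointwise stabilizer `st(n)` of the `n`-th level of the tree. -/
def levelStab (p n : ℕ) : Subgroup (AutT p) where
  carrier := {f | ∀ v : List (Fin p), v.length = n → act f v = v}
  one_mem' := fun v _ => act_one v
  mul_mem' := by
    intro f g hf hg v hv
    rw [act_mul, hg v hv, hf v hv]
  inv_mem' := by
    intro f hf v hv
    have h1 : act f (act f⁻¹ v) = v := act_act_inv f v
    have h2 : act f (act f⁻¹ v) = act f⁻¹ v := hf _ (by rw [act_length, hv])
    exact h2.symm.trans h1

instance levelStab_normal (p n : ℕ) : (levelStab p n).Normal := by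
  constructor
  intro f hf g v hv
  show act (g * f * g⁻¹) v = v
  rw [act_mul, act_mul, hf _ (by rw [act_length, hv]), act_act_inv]

/-- The tuple of sections at the level-two vertices.  Restricted to the
second-level stabilizer this is the map `ψ₂`. -/
def sections2 (f : AutT p) : Fin p → Fin p → AutT p := fun x y v => f (x :: y :: v)

/-- The rooted automorphism defined by a permutation `σ` of `Fin p`. -/
def rooted (σ : Equiv.Perm (Fin p)) : AutT p := fun v => if v = [] then σ else 1

/-- The rooted automorphism `a`, acting at the root by the cycle `(1 2 … p)`. -/
def rootedA (p : ℕ) : AutT p := rooted (finRotate p)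

/-- Auxiliary portrait for the directed automorphism `b_e`. -/
def directedAux (e : Fin (p - 1) → ZMod p) : List (Fin p) → Equiv.Perm (Fin p)
  | [] => 1
  | x :: w =>
      if h : (x : ℕ) < p - 1 then
        (if w = [] then finRotate p ^ ((e ⟨x, h⟩).val) else 1)
      else directedAux e w

/-- The directed automorphism `b_e` defined by the vector `e ∈ 𝔽_p^{p-1}`,
i.e. the unique automorphism with `ψ(b_e) = (a^{e_1}, …, a^{e_{p-1}}, b_e)`. -/
def directed (e : Fin (p - 1) → ZMod p) : AutT p := directedAux e

/-- The multi-GGS-group determined by the vectors `e 1, …, e r`. -/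
def multiGGS (p : ℕ) {r : ℕ} (e : Fin r → Fin (p - 1) → ZMod p) : Subgroup (AutT p) :=
  Subgroup.closure ({rootedA p} ∪ Set.range fun i => directed (e i))

/-- The GGS-group `𝒢` defined by the (nonzero) constant vector `(c, …, c)`. -/
def constGGS (p : ℕ) (c : ZMod p) : Subgroup (AutT p) :=
  Subgroup.closure {rootedA p, directed (fun _ => c)}

/-- `G` is the GGS-group `𝒢` defined by a constant vector. -/
def IsConstGGS {p : ℕ} (G : Subgroup (AutT p)) : Prop :=
  ∃ c : ZMod p, c ≠ 0 ∧ G = constGGS p c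

/-- The stabilizer `st_G(n) = G ∩ st(n)`, viewed as a subgroup of `G`. -/
def stabIn {p : ℕ} (G : Subgroup (AutT p)) (n : ℕ) : Subgroup G :=
  (levelStab p n).comap G.subtype

instance {p : ℕ} (G : Subgroup (AutT p)) (n : ℕ) : (stabIn G n).Normal :=
  Subgroup.Normal.comap (levelStab_normal p n) G.subtype

/-- The congruence subgroup property: every finite-index subgroup of `G`
contains a level stabilizer `st_G(n)`. -/
def HasCSP {p : ℕ} (G : Subgroup (AutT p)) : Prop :=
  ∀ H : Subgroup G, H.FiniteIndex → ∃ n : ℕ, stabIn G n ≤ H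

/-- `G` is just infinite: it is infinite and all its nontrivial normal
subgroups have finite index. -/
def JustInfinite {p : ℕ} (G : Subgroup (AutT p)) : Prop :=
  Infinite G ∧ ∀ N : Subgroup G, N.Normal → N ≠ ⊥ → N.FiniteIndex

end AutT

end TreeAut

open TreeAut AutT Subgroup

lemma finRotate_pow_self (p : ℕ) : finRotate p ^ p = 1 := by
  match p with
  | 0 => rfl
  | 1 => exact Subsingleton.elim _ _
  | n + 2 =>
    have h := (isCycle_finRotate (n := n)).orderOf
    rw [support_finRotate, Finset.card_univ, Fintype.card_fin] at h
    exact orderOf_dvd_iff_pow_eq_one.mp h.dvd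

lemma finRotate_pow_val_add {p : ℕ} [NeZero p] (x y : ZMod p) :
    finRotate p ^ (x + y).val = finRotate p ^ x.val * finRotate p ^ y.val := by
  rw [ZMod.val_add, ← pow_add]
  exact (pow_eq_pow_mod _ (finRotate_pow_self p)).symm

lemma act_eq_nil_iff {p : ℕ} (g : AutT p) (v : List (Fin p)) : act g v = [] ↔ v = [] := by
  rw [← List.length_eq_zero_iff, act_length, List.length_eq_zero_iff]

lemma directed_nil {p : ℕ} (e : Fin (p - 1) → ZMod p) : directed e [] = 1 := rfl

lemma directed_cons_of_lt {p : ℕ} (e : Fin (p - 1) → ZMod p) {x : Fin p}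
    (h : (x : ℕ) < p - 1) (w : List (Fin p)) :
    directed e (x :: w) = if w = [] then finRotate p ^ (e ⟨x, h⟩).val else 1 :=
  dif_pos h

lemma directed_cons_of_not_lt {p : ℕ} (e : Fin (p - 1) → ZMod p) {x : Fin p}
    (h : ¬ (x : ℕ) < p - 1) (w : List (Fin p)) :
    directed e (x :: w) = directed e w :=
  dif_neg h

lemma act_directed_cons {p : ℕ} (e : Fin (p - 1) → ZMod p) (x : Fin p) (w : List (Fin p)) :
    act (directed e) (x :: w) = x :: act (sections (directed e) x) w := by
  rw [act_cons, directed_nil, Equiv.Perm.one_apply]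

lemma sections_directed_of_not_lt {p : ℕ} (e : Fin (p - 1) → ZMod p) {x : Fin p}
    (h : ¬ (x : ℕ) < p - 1) : sections (directed e) x = directed e :=
  funext fun w => directed_cons_of_not_lt e h w

lemma directed_add {p : ℕ} [NeZero p] (e f : Fin (p - 1) → ZMod p) :
    directed (e + f) = directed e * directed f := by
  funext v
  rw [mul_apply]
  induction v with
  | nil => simp [act_nil, directed_nil]
  | cons x w ih =>
    rw [act_directed_cons]
    by_cases h : (x : ℕ) < p - 1
    · simp only [directed_cons_of_lt _ h, act_eq_nil_iff]
      split_ifs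
      · exact finRotate_pow_val_add _ _
      · exact (mul_one 1).symm
    · simp only [directed_cons_of_not_lt _ h, sections_directed_of_not_lt _ h, ih]

lemma directed_zero {p : ℕ} [NeZero p] : directed (0 : Fin (p - 1) → ZMod p) = 1 := by
  have h := directed_add (0 : Fin (p - 1) → ZMod p) 0
  rwa [add_zero, left_eq_mul] at h

lemma directed_nsmul {p : ℕ} [NeZero p] (n : ℕ) (e : Fin (p - 1) → ZMod p) :
    directed (n • e) = directed e ^ n := by
  induction n with
  | zero => rw [zero_smul, pow_zero, directed_zero]
  | succ n ih => rw [succ_nsmul, directed_add, ih, pow_succ]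

lemma directed_mem_multiGGS_of_mem_span {p r : ℕ} [NeZero p] (e : Fin r → Fin (p - 1) → ZMod p)
    {x : Fin (p - 1) → ZMod p} (hx : x ∈ Submodule.span (ZMod p) (Set.range e)) :
    directed x ∈ multiGGS p e := by
  induction hx using Submodule.span_induction with
  | mem x hx =>
    obtain ⟨i, rfl⟩ := hx
    exact subset_closure (Or.inr ⟨i, rfl⟩)
  | zero => exact directed_zero (p := p) ▸ one_mem _
  | add x y _ _ hx hy => exact directed_add x y ▸ mul_mem hx hy
  | smul c x _ hx =>
    rw [← ZMod.natCast_zmod_val c, Nat.cast_smul_eq_nsmul, directed_nsmul]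
    exact pow_mem hx _

lemma multiGGS_le_of_span_le {p r s : ℕ} [NeZero p] (e : Fin r → Fin (p - 1) → ZMod p)
    (f : Fin s → Fin (p - 1) → ZMod p)
    (h : Submodule.span (ZMod p) (Set.range e) ≤ Submodule.span (ZMod p) (Set.range f)) :
    multiGGS p e ≤ multiGGS p f := by
  refine (closure_le _).mpr (Set.union_subset ?_ ?_)
  · exact Set.singleton_subset_iff.mpr (subset_closure (Or.inl rfl))
  · rintro _ ⟨i, rfl⟩
    exact directed_mem_multiGGS_of_mem_span f (h (Submodule.subset_span ⟨i, rfl⟩))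

/-- The multi-GGS-group depends only on the span of its defining vectors:
two linearly independent families with the same span define the same group. -/
theorem multiGGS_eq_of_span_eq
    (p r s : ℕ) (hp : p.Prime) (hpodd : Odd p)
    (e : Fin r → Fin (p - 1) → ZMod p) (f : Fin s → Fin (p - 1) → ZMod p)
    (he : LinearIndependent (ZMod p) e) (hf : LinearIndependent (ZMod p) f)
    (hspan : Submodule.span (ZMod p) (Set.range e) = Submodule.span (ZMod p) (Set.range f)) :
    multiGGS p e = multiGGS p f := by
  have : NeZero p := ⟨hp.ne_zero⟩
  exact le_antisymm (multiGGS_le_of_span_le e f hspan.le) (multiGGS_le_of_span_le f e hspan.ge)
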